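/- Mixed ℓ₂/ℓ_q error bound for the block Dantzig selector (BDS) with block compressible signals: let q > 1 be real, k ≥ 1, and let x be any block signal. Let S be a set of k block indices containing k largest blocks of x (i.e. ‖x_i‖₂ ≥ ‖x_j‖₂ whenever i ∈ S and j ∉ S), and set φ = ∑_{i∉S} ‖x_i‖₂ (the best block k-term approximation error φ_k(x)). Let μ ≥ 0, ε with ‖Aᵀε‖_{2,∞} ≤ μ, y = A x + ε, and let x̂ satisfy ‖Aᵀ(y − A x̂)‖_{2,∞} ≤ μ and ‖x̂‖_{2,1} ≤ ‖z‖_{2,1} for every z with ‖Aᵀ(y − A z)‖_{2,∞} ≤ μ. Suppose β > 0 is such that ‖A z‖₂ ≥ β·‖z‖_{2,q} for every z with ‖z‖_{2,1} ≤ 4·k^{1-1/q}·‖z‖_{2,q}. Then ‖x̂ − x‖_{2,q} ≤ 8·k^{1-1/q}·μ/β² + k^{1/q-1}·φ. -/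

import Mathlib

open scoped BigOperators

noncomputable section

/-- Mixed ℓ₂/ℓ₁ norm of a block signal: sum of the Euclidean norms of the blocks. -/
def mnorm1 {p n : ℕ} (x : Fin p → EuclideanSpace ℝ (Fin n)) : ℝ := ∑ i, ‖x i‖

/-- Mixed ℓ₂/ℓ_q norm of a block signal. -/
def mnorm {p n : ℕ} (q : ℝ) (x : Fin p → EuclideanSpace ℝ (Fin n)) : ℝ :=
  (∑ i, ‖x i‖ ^ q) ^ (1 / q)

/-- Mixed ℓ₂/ℓ_∞ norm of a block signal: the largest block norm. -/
def mnormInf {p n : ℕ} (x : Fin p → EuclideanSpace ℝ (Fin n)) : ℝ := ⨆ i, ‖x i‖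

/-- Hölder's inequality against the indicator of `S`. -/
theorem sum_norm_le_card_rpow_mul_mnorm {p n : ℕ} {q : ℝ} (hq : 1 < q) (S : Finset (Fin p))
    (h : Fin p → EuclideanSpace ℝ (Fin n)) :
    ∑ i ∈ S, ‖h i‖ ≤ (S.card : ℝ) ^ (1 - 1 / q) * mnorm q h := by
  have hpq : (q.conjExponent).HolderConjugate q := (Real.HolderConjugate.conjExponent hq).symm
  have key := Real.inner_le_Lp_mul_Lq S (fun _ => (1 : ℝ)) (fun i => ‖h i‖) hpq
  have hexp : 1 / q.conjExponent = 1 - 1 / q := by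
    have := hpq.inv_add_inv_eq_one
    simp only [one_div]
    linarith
  simp only [one_mul, abs_one, Real.one_rpow, abs_norm, Finset.sum_const, nsmul_eq_mul, mul_one,
    hexp] at key
  refine key.trans ?_
  unfold mnorm
  gcongr
  exact Finset.subset_univ S

theorem norm_le_mnormInf {p n : ℕ} (x : Fin p → EuclideanSpace ℝ (Fin n)) (i : Fin p) :
    ‖x i‖ ≤ mnormInf x :=
  le_ciSup (f := fun i => ‖x i‖) (Set.finite_range _).bddAbove i

theorem inner_le_mnormInf_mul_mnorm1 {p n : ℕ}
    (u v : PiLp 2 (fun _ : Fin p => EuclideanSpace ℝ (Fin n))) :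
    inner ℝ u v ≤ mnormInf u * mnorm1 v := by
  rw [PiLp.inner_apply, mnorm1, Finset.mul_sum]
  exact Finset.sum_le_sum fun i _ => (real_inner_le_norm _ _).trans
    (mul_le_mul_of_nonneg_right (norm_le_mnormInf _ i) (norm_nonneg _))

/-- The cone condition satisfied by an error `h` which does not increase the mixed ℓ₂/ℓ₁ norm. -/
theorem mnorm1_le_of_mnorm1_add_le {p n : ℕ} (x h : Fin p → EuclideanSpace ℝ (Fin n))
    (S : Finset (Fin p)) (hle : mnorm1 (x + h) ≤ mnorm1 x) :
    mnorm1 h ≤ 2 * ∑ i ∈ S, ‖h i‖ + 2 * ∑ i ∈ Sᶜ, ‖x i‖ := by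
  simp only [mnorm1, ← Finset.sum_add_sum_compl S, Pi.add_apply] at hle ⊢
  have h₁ : ∑ i ∈ S, ‖x i‖ - ∑ i ∈ S, ‖h i‖ ≤ ∑ i ∈ S, ‖x i + h i‖ := by
    rw [← Finset.sum_sub_distrib]
    exact Finset.sum_le_sum fun i _ => by
      simpa using norm_sub_norm_le (x i) (-h i)
  have h₂ : ∑ i ∈ Sᶜ, ‖h i‖ - ∑ i ∈ Sᶜ, ‖x i‖ ≤ ∑ i ∈ Sᶜ, ‖x i + h i‖ := by
    rw [← Finset.sum_sub_distrib]
    exact Finset.sum_le_sum fun i _ => by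
      simpa [add_comm] using norm_sub_norm_le (h i) (-x i)
  linarith

/-- Mixed ℓ₂/ℓ_q error bound for the block Dantzig selector with block compressible signals. -/
theorem stmt_13 {p n m : ℕ}
    (A : PiLp 2 (fun _ : Fin p => EuclideanSpace ℝ (Fin n)) →L[ℝ] EuclideanSpace ℝ (Fin m))
    (q : ℝ) (hq : 1 < q) (k : ℕ) (hk : 1 ≤ k)
    (x : PiLp 2 (fun _ : Fin p => EuclideanSpace ℝ (Fin n)))
    (S : Finset (Fin p)) (hScard : S.card = k)
    (hSlargest : ∀ i ∈ S, ∀ j ∉ S, ‖x j‖ ≤ ‖x i‖)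
    (φ : ℝ) (hφ : φ = ∑ i ∈ Sᶜ, ‖x i‖)
    (μ : ℝ) (hμ : 0 ≤ μ)
    (ε : EuclideanSpace ℝ (Fin m))
    (hε : mnormInf (ContinuousLinearMap.adjoint A ε) ≤ μ)
    (y : EuclideanSpace ℝ (Fin m)) (hy : y = A x + ε)
    (xh : PiLp 2 (fun _ : Fin p => EuclideanSpace ℝ (Fin n)))
    (hfeas : mnormInf (ContinuousLinearMap.adjoint A (y - A xh)) ≤ μ)
    (hmin : ∀ z : PiLp 2 (fun _ : Fin p => EuclideanSpace ℝ (Fin n)),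
      mnormInf (ContinuousLinearMap.adjoint A (y - A z)) ≤ μ → mnorm1 xh ≤ mnorm1 z)
    (β : ℝ) (hβ : 0 < β)
    (hcmsv : ∀ z : PiLp 2 (fun _ : Fin p => EuclideanSpace ℝ (Fin n)),
      mnorm1 z ≤ 4 * (k : ℝ) ^ (1 - 1 / q) * mnorm q z → β * mnorm q z ≤ ‖A z‖) :
    mnorm q (xh - x) ≤ 8 * (k : ℝ) ^ (1 - 1 / q) * μ / β ^ 2 + (k : ℝ) ^ (1 / q - 1) * φ := by
  obtain ⟨h, rfl⟩ : ∃ h, xh = x + h := ⟨xh - x, by abel⟩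
  have hx : mnorm1 (x + h) ≤ mnorm1 x := hmin x (by simpa [hy] using hε)
  have hcone := mnorm1_le_of_mnorm1_add_le x h S hx
  have hholder := sum_norm_le_card_rpow_mul_mnorm hq S h
  rw [hScard] at hholder
  rw [← hφ] at hcone
  have hφ0 : 0 ≤ φ := hφ ▸ Finset.sum_nonneg fun i _ => norm_nonneg _
  have hN0 : 0 ≤ mnorm q h := by unfold mnorm; positivity
  have hk0 : (0 : ℝ) < k := by exact_mod_cast hk
  have hc0 : 0 < (k : ℝ) ^ (1 - 1 / q) := by positivity
  have hinv : (k : ℝ) ^ (1 / q - 1) = ((k : ℝ) ^ (1 - 1 / q))⁻¹ := by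
    rw [← Real.rpow_neg hk0.le, neg_sub]
  have hdiff : mnorm q (x + h - x) = mnorm q h := by
    congr 1
    exact add_sub_cancel_left _ _
  refine (le_of_eq hdiff).trans ?_
  rw [hinv]
  set c := (k : ℝ) ^ (1 - 1 / q)
  set N := mnorm q h
  by_cases hcase : mnorm1 h ≤ 4 * c * N
  · have hA := hcmsv h hcase
    have hM0 : 0 ≤ mnorm1 h := Finset.sum_nonneg fun i _ => norm_nonneg _
    have hsq : ‖A h‖ ^ 2 ≤ 2 * μ * mnorm1 h := by
      have e : A h = ε - (y - A (x + h)) := by rw [hy, map_add]; abel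
      have e₁ := inner_le_mnormInf_mul_mnorm1 (ContinuousLinearMap.adjoint A ε) h
      have e₂ := inner_le_mnormInf_mul_mnorm1
        (ContinuousLinearMap.adjoint A (y - A (x + h))) (-h)
      have hneg : mnorm1 (-h) = mnorm1 h := by simp [mnorm1]
      rw [ContinuousLinearMap.adjoint_inner_left] at e₁ e₂
      rw [map_neg, inner_neg_right] at e₂
      have e₃ : ‖A h‖ ^ 2 = inner ℝ ε (A h) - inner ℝ (y - A (x + h)) (A h) := by
        rw [← inner_sub_left, ← e, real_inner_self_eq_norm_sq]
      have e₄ := mul_le_mul_of_nonneg_right hε hM0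
      have e₅ := mul_le_mul_of_nonneg_right hfeas hM0
      have e₆ := e₂.trans ((congrArg _ hneg).le.trans e₅)
      linarith
    have hb : β ^ 2 * N ^ 2 ≤ 8 * c * μ * N := by
      have := pow_le_pow_left₀ (by positivity) hA 2
      have := mul_le_mul_of_nonneg_left hcase (by positivity : 0 ≤ 2 * μ)
      linarith [mul_pow β N 2]
    have hN : N ≤ 8 * c * μ / β ^ 2 := by
      rcases hN0.eq_or_lt with h0 | hpos
      · rw [← h0]; positivity
      · rw [le_div_iff₀ (by positivity)]
        exact le_of_mul_le_mul_right (by linarith) hpos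
    have : 0 ≤ c⁻¹ * φ := by positivity
    linarith
  · push Not at hcase
    have hN : N ≤ c⁻¹ * φ := by
      rw [inv_mul_eq_div, le_div_iff₀ hc0]
      linarith
    have : 0 ≤ 8 * c * μ / β ^ 2 := by positivity
    linarith
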